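/- Let G₄ be the 6×6 matrix (1/2)·[2,1,1,0,1,1; 1,2,1,1,0,1; 1,1,2,1,1,2; 0,1,1,2,1,1; 1,0,1,1,2,1; 1,1,2,1,1,2]. Then ∑_{N₁,...,N₆≥0} (-1)^{N₁+N₂+N₄+N₅} q^{NᵀG₄N} / ∏_i (q²;q²)_{N_i} = (q;q)_∞² (q³;q³)_∞² / ((q²;q²)_∞³ (q⁶;q⁶)_∞). -/

import Mathlib

open scoped BigOperators

/-- Finite q-Pochhammer symbol $(a;q)_n$. -/
noncomputable def qPoch (q a : ℂ) (n : ℕ) : ℂ := ∏ j ∈ Finset.range n, (1 - a * q ^ j)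

/-- Infinite q-Pochhammer symbol $(a;q)_\infty$. -/
noncomputable def qPochInf (q a : ℂ) : ℂ := ∏' j : ℕ, (1 - a * q ^ j)

/-- The quadratic form $N^T G_4 N$ for the $6\times 6$ matrix
$G_4=\frac12\begin{pmatrix}2&1&1&0&1&1\\1&2&1&1&0&1\\1&1&2&1&1&2\\0&1&1&2&1&1\\1&0&1&1&2&1\\1&1&2&1&1&2\end{pmatrix}$. -/
def Q4 (n₁ n₂ n₃ n₄ n₅ n₆ : ℕ) : ℕ :=
  n₁ ^ 2 + n₂ ^ 2 + n₃ ^ 2 + n₄ ^ 2 + n₅ ^ 2 + n₆ ^ 2 +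
    n₁ * n₂ + n₁ * n₃ + n₁ * n₅ + n₁ * n₆ +
    n₂ * n₃ + n₂ * n₄ + n₂ * n₆ +
    n₃ * n₄ + n₃ * n₅ + 2 * (n₃ * n₆) +
    n₄ * n₅ + n₄ * n₆ + n₅ * n₆

open Filter Topology

lemma one_sub_pow_succ_ne_zero {p : ℂ} (hp : ‖p‖ < 1) (n : ℕ) : 1 - p ^ (n + 1) ≠ 0 := by
  intro h
  have h1 : ‖p ^ (n + 1)‖ < 1 := by
    rw [norm_pow]
    exact pow_lt_one₀ (norm_nonneg _) hp n.succ_ne_zero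
  rw [← sub_eq_zero.mp h, norm_one] at h1
  exact lt_irrefl _ h1

lemma summable_norm_mul_pow {p : ℂ} (hp : ‖p‖ < 1) (a : ℂ) :
    Summable fun j : ℕ ↦ ‖-(a * p ^ j)‖ := by
  simp only [norm_neg, norm_mul, norm_pow]
  exact (summable_geometric_of_lt_one (norm_nonneg _) hp).mul_left _

lemma multipliable_one_sub_mul_pow {p : ℂ} (hp : ‖p‖ < 1) (a : ℂ) :
    Multipliable fun j : ℕ ↦ 1 - a * p ^ j := by
  simpa only [sub_eq_add_neg] using multipliable_one_add_of_summable (summable_norm_mul_pow hp a)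

lemma tendsto_qPoch {p : ℂ} (hp : ‖p‖ < 1) (a : ℂ) :
    Tendsto (qPoch p a) atTop (𝓝 (qPochInf p a)) :=
  (multipliable_one_sub_mul_pow hp a).hasProd.tendsto_prod_nat

lemma qPochInf_self_ne_zero {p : ℂ} (hp : ‖p‖ < 1) : qPochInf p p ≠ 0 := by
  have h := tprod_one_add_ne_zero_of_summable (f := fun j : ℕ ↦ -(p * p ^ j)) (fun j ↦ by
    rw [← sub_eq_add_neg, ← pow_succ']
    exact one_sub_pow_succ_ne_zero hp j) (summable_norm_mul_pow hp p)
  simpa only [qPochInf, sub_eq_add_neg] using h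

/-- The reciprocal `1 / (p;p)_n`, extended by zero to negative `n`. -/
noncomputable def invPoch (p : ℂ) (n : ℤ) : ℂ := if 0 ≤ n then (qPoch p p n.toNat)⁻¹ else 0

lemma invPoch_natCast (p : ℂ) (n : ℕ) : invPoch p n = (qPoch p p n)⁻¹ := by simp [invPoch]

lemma invPoch_zero (p : ℂ) : invPoch p 0 = 1 := by simp [invPoch, qPoch]

lemma invPoch_of_neg (p : ℂ) {n : ℤ} (hn : n < 0) : invPoch p n = 0 := by
  simp [invPoch, not_le.mpr hn]

lemma one_sub_zpow_mul_invPoch {p : ℂ} (hp : ‖p‖ < 1) (n : ℤ) :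
    (1 - p ^ n) * invPoch p n = invPoch p (n - 1) := by
  rcases lt_trichotomy n 0 with hn | rfl | hn
  · rw [invPoch_of_neg p hn, invPoch_of_neg p (by lia), mul_zero]
  · simp [invPoch_of_neg]
  · obtain ⟨k, rfl⟩ : ∃ k : ℕ, n = (k + 1 : ℕ) := ⟨(n - 1).toNat, by lia⟩
    rw [show ((k + 1 : ℕ) : ℤ) - 1 = k by push_cast; ring, invPoch_natCast, invPoch_natCast,
      zpow_natCast, qPoch, Finset.prod_range_succ, ← qPoch, mul_inv, ← pow_succ']
    field_simp [one_sub_pow_succ_ne_zero hp k]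

lemma tendsto_invPoch {p : ℂ} (hp : ‖p‖ < 1) :
    Tendsto (invPoch p) atTop (𝓝 (qPochInf p p)⁻¹) := by
  have h : Tendsto Int.toNat atTop atTop :=
    tendsto_atTop.mpr fun b ↦ (eventually_ge_atTop (b : ℤ)).mono fun n hn ↦ by lia
  refine (((tendsto_qPoch hp p).inv₀ (qPochInf_self_ne_zero hp)).comp h).congr' ?_
  filter_upwards [eventually_ge_atTop 0] with n hn
  simp [invPoch, hn]

lemma exists_norm_invPoch_le {p : ℂ} (hp : ‖p‖ < 1) : ∃ C, 0 ≤ C ∧ ∀ n, ‖invPoch p n‖ ≤ C := by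
  obtain ⟨C, hC⟩ := ((tendsto_qPoch hp p).inv₀ (qPochInf_self_ne_zero hp)).norm.bddAbove_range
  have h0 : 0 ≤ C := (norm_nonneg _).trans (hC ⟨0, rfl⟩)
  refine ⟨C, h0, fun n ↦ ?_⟩
  rcases lt_or_ge n 0 with hn | hn
  · simpa [invPoch_of_neg p hn] using h0
  · lift n to ℕ using hn
    rw [invPoch_natCast]
    exact hC ⟨n, rfl⟩

lemma summable_pow_natAbs {x : ℝ} (hx0 : 0 ≤ x) (hx : x < 1) :
    Summable fun n : ℤ ↦ x ^ n.natAbs := by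
  have h := summable_geometric_of_lt_one hx0 hx
  exact Summable.of_nat_of_neg (by simpa using h) (by simpa using h)

/-- A terminating q-Vandermonde sum. -/
lemma tsum_invPoch_mul_mul {p : ℂ} (hp : ‖p‖ < 1) (hp0 : p ≠ 0) (i j : ℤ) :
    ∑' s : ℤ, p ^ ((i - s) * (j - s)) * (invPoch p (i - s) * invPoch p (j - s) * invPoch p s)
      = invPoch p i * invPoch p j := by
  rcases lt_or_ge i 0 with hi | hi
  · rw [invPoch_of_neg p hi, zero_mul, ← tsum_zero (α := ℂ) (β := ℤ)]
    refine tsum_congr fun s ↦ ?_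
    rcases lt_or_ge s 0 with hs | hs
    · simp [invPoch_of_neg p hs]
    · simp [invPoch_of_neg p (show i - s < 0 by lia)]
  lift i to ℕ using hi
  induction i generalizing j with
  | zero =>
    rw [tsum_eq_single 0]
    · simp [invPoch_zero]
    · intro s hs
      rcases lt_or_ge s 0 with hs' | hs'
      · simp [invPoch_of_neg p hs']
      · simp [invPoch_of_neg p (show -s < 0 by lia)]
  | succ i ih =>
    have hsum (i j : ℤ) : Summable fun s : ℤ ↦
        p ^ ((i - s) * (j - s)) * (invPoch p (i - s) * invPoch p (j - s) * invPoch p s) := by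
      refine summable_of_ne_finset_zero (s := Finset.Icc 0 i) fun s hs ↦ ?_
      rw [Finset.mem_Icc, not_and_or, not_le, not_le] at hs
      rcases hs with hs | hs
      · simp [invPoch_of_neg p hs]
      · simp [invPoch_of_neg p (show i - s < 0 by lia)]
    have hne : 1 - p ^ ((i + 1 : ℕ) : ℤ) ≠ 0 := by
      rw [zpow_natCast]
      exact one_sub_pow_succ_ne_zero hp i
    refine mul_left_cancel₀ hne ?_
    have hrec := one_sub_zpow_mul_invPoch hp ((i + 1 : ℕ) : ℤ)
    rw [← mul_assoc, hrec, ← tsum_mul_left]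
    push_cast
    rw [add_sub_cancel_right]
    have hshift := (Equiv.subRight (1 : ℤ)).tsum_eq fun s : ℤ ↦
      p ^ ((i - s) * (j - 1 - s)) * (invPoch p (i - s) * invPoch p (j - 1 - s) * invPoch p s)
    have hs1 := (Equiv.subRight (1 : ℤ)).summable_iff.mpr (hsum i (j - 1))
    simp only [Function.comp_def, Equiv.subRight_apply] at hs1 hshift
    have key (s : ℤ) : (1 - p ^ ((i : ℤ) + 1)) * (p ^ (((i : ℤ) + 1 - s) * (j - s)) *
          (invPoch p (i + 1 - s) * invPoch p (j - s) * invPoch p s)) =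
        p ^ (((i : ℤ) - (s - 1)) * (j - 1 - (s - 1))) * (invPoch p (i - (s - 1)) *
          invPoch p (j - 1 - (s - 1)) * invPoch p (s - 1)) +
        p ^ j * (p ^ (((i : ℤ) - s) * (j - s)) *
          (invPoch p (i - s) * invPoch p (j - s) * invPoch p s)) := by
      have hA : p ^ ((i : ℤ) + 1) = p ^ s * p ^ ((i : ℤ) + 1 - s) := by
        rw [← zpow_add₀ hp0, add_sub_cancel]
      have hB : p ^ s * p ^ (((i : ℤ) + 1 - s) * (j - s)) =
          p ^ j * p ^ (((i : ℤ) + 1 - s - 1) * (j - s)) := by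
        rw [← zpow_add₀ hp0, ← zpow_add₀ hp0]
        ring_nf
      rw [show (i : ℤ) - (s - 1) = i + 1 - s by ring, show j - 1 - (s - 1) = j - s by ring,
        ← one_sub_zpow_mul_invPoch hp s, show (i : ℤ) - s = i + 1 - s - 1 by ring,
        ← one_sub_zpow_mul_invPoch hp (i + 1 - s)]
      linear_combination invPoch p (i + 1 - s) * invPoch p (j - s) * invPoch p s *
        ((1 - p ^ ((i : ℤ) + 1 - s)) * hB - p ^ (((i : ℤ) + 1 - s) * (j - s)) * hA)
    rw [tsum_congr key, Summable.tsum_add hs1 ((hsum i j).mul_left _), tsum_mul_left, ih]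
    rw [hshift, ih, ← one_sub_zpow_mul_invPoch hp j]
    ring

lemma norm_zpow_le_of_le {q : ℂ} (hq : ‖q‖ < 1) (hq0 : q ≠ 0) {a b : ℤ} (h : a ≤ b) :
    ‖q ^ b‖ ≤ ‖q‖ ^ a := by
  rw [norm_zpow]
  exact zpow_le_zpow_right_of_le_one₀ (norm_pos_iff.mpr hq0) hq.le h

/-- Durfee rectangle identity. -/
lemma tsum_durfee {p : ℂ} (hp : ‖p‖ < 1) (hp0 : p ≠ 0) (m : ℤ) :
    ∑' k : ℤ, p ^ (k * (k + m)) * (invPoch p (k + m) * invPoch p k) = (qPochInf p p)⁻¹ := by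
  obtain ⟨C, hC0, hC⟩ := exists_norm_invPoch_le hp
  set P := qPochInf p p
  have hP : P⁻¹ ≠ 0 := inv_ne_zero (qPochInf_self_ne_zero hp)
  have hbound : Summable fun k : ℤ ↦ ‖p‖ ^ (-|m|) * ‖p‖ ^ k.natAbs * (C * C * C) :=
    ((summable_pow_natAbs (norm_nonneg p) hp).mul_left _).mul_right _
  have hlim := tendsto_tsum_of_dominated_convergence (𝓕 := atTop)
    (f := fun (i : ℤ) (k : ℤ) ↦
      p ^ (k * (k + m)) * (invPoch p (k + m) * invPoch p k * invPoch p (i - k)))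
    (g := fun k ↦ p ^ (k * (k + m)) * (invPoch p (k + m) * invPoch p k * P⁻¹)) hbound
    (fun k ↦ (((tendsto_invPoch hp).comp
      (tendsto_atTop_add_const_right _ (-k) tendsto_id)).const_mul _).const_mul _)
    (Eventually.of_forall fun i k ↦ by
      rw [norm_mul]
      rcases lt_or_ge k 0 with hk | hk
      · rw [invPoch_of_neg p hk]
        simp only [mul_zero, zero_mul, norm_zero]
        positivity
      rcases lt_or_ge (k + m) 0 with hkm | hkm
      · rw [invPoch_of_neg p hkm]
        simp only [mul_zero, zero_mul, norm_zero]
        positivity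
      have hle : -|m| + (k.natAbs : ℤ) ≤ k * (k + m) := by
        rw [Int.natCast_natAbs, abs_of_nonneg hk]
        rcases hkm.eq_or_lt with h | h
        · have := neg_le_abs m
          rw [← h]
          lia
        · have := abs_nonneg m
          nlinarith
      refine mul_le_mul ?_ ?_ (norm_nonneg _) (by positivity)
      · refine (norm_zpow_le_of_le hp hp0 hle).trans_eq ?_
        rw [zpow_add₀ (norm_ne_zero_iff.mpr hp0), zpow_natCast]
      · rw [norm_mul, norm_mul]
        gcongr <;> exact hC _)
  have heq (i : ℤ) : ∑' k : ℤ, p ^ (k * (k + m)) *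
      (invPoch p (k + m) * invPoch p k * invPoch p (i - k)) = invPoch p i * invPoch p (i + m) := by
    rw [← tsum_invPoch_mul_mul hp hp0 i (i + m), ← (Equiv.subLeft i).tsum_eq]
    refine tsum_congr fun k ↦ ?_
    simp only [Equiv.subLeft_apply]
    rw [show i - k + m = i + m - k by ring, sub_sub_cancel]
    ring
  simp only [heq] at hlim
  have hlim' : Tendsto (fun i : ℤ ↦ invPoch p i * invPoch p (i + m)) atTop (𝓝 (P⁻¹ * P⁻¹)) :=
    (tendsto_invPoch hp).mul
      ((tendsto_invPoch hp).comp (tendsto_atTop_add_const_right _ m tendsto_id))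
  have := tendsto_nhds_unique hlim hlim'
  simp only [← mul_assoc] at this
  rw [tsum_mul_right] at this
  simpa only [← mul_assoc] using mul_right_cancel₀ hP this

lemma norm_sq_lt_one {q : ℂ} (hq : ‖q‖ < 1) : ‖q ^ 2‖ < 1 := by
  rw [norm_pow]
  exact pow_lt_one₀ (norm_nonneg _) hq two_ne_zero

/-- A finite form of the triple product sum at `z = -1`. -/
lemma tsum_neg_one_zpow_mul_invPoch {q : ℂ} (hq : ‖q‖ < 1) (hq0 : q ≠ 0) (a b : ℕ) :
    ∑' m : ℤ, (-1) ^ m * q ^ (m ^ 2) * (invPoch (q ^ 2) (a + m) * invPoch (q ^ 2) (b - m))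
      = qPoch (q ^ 2) q a * qPoch (q ^ 2) q b * invPoch (q ^ 2) ((a + b : ℕ) : ℤ) := by
  have hp := norm_sq_lt_one hq
  set W : ℤ → ℤ → ℤ → ℂ := fun a b m ↦
    (-1) ^ m * q ^ (m ^ 2) * (invPoch (q ^ 2) (a + m) * invPoch (q ^ 2) (b - m)) with hW
  have hsum (a b : ℤ) : Summable (W a b) := by
    refine summable_of_ne_finset_zero (s := Finset.Icc (-a) b) fun s hs ↦ ?_
    rw [Finset.mem_Icc, not_and_or, not_le, not_le] at hs
    rcases hs with hs | hs
    · simp [hW, invPoch_of_neg _ (show a + s < 0 by lia)]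
    · simp [hW, invPoch_of_neg _ (show b - s < 0 by lia)]
  have hrec (a b : ℤ) : (1 - (q ^ 2) ^ (a + b)) * ∑' m, W a b m =
      (1 - q ^ (2 * b - 1)) * ∑' m, W a (b - 1) m := by
    have hs1 := (Equiv.subRight (1 : ℤ)).summable_iff.mpr (hsum a (b - 1))
    have hshift := (Equiv.subRight (1 : ℤ)).tsum_eq (W a (b - 1))
    have key (m : ℤ) : (1 - (q ^ 2) ^ (a + b)) * W a b m =
        W a (b - 1) m - q ^ (2 * b - 1) * (W a (b - 1) ∘ Equiv.subRight (1 : ℤ)) m := by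
      simp only [hW, Function.comp, Equiv.subRight_apply]
      rw [show b - 1 - m = b - m - 1 by ring, ← one_sub_zpow_mul_invPoch hp (b - m),
        show b - 1 - (m - 1) = b - m by ring, show a + (m - 1) = a + m - 1 by ring,
        ← one_sub_zpow_mul_invPoch hp (a + m), zpow_sub₀ (neg_ne_zero.mpr one_ne_zero : (-1 : ℂ) ≠ 0),
        show a + b = (b - m) + (a + m) by ring, zpow_add₀ (pow_ne_zero 2 hq0),
        show (m - 1) ^ 2 = m ^ 2 + (1 - 2 * m) by ring, zpow_add₀ hq0 (m ^ 2)]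
      have h : q ^ (2 * b - 1) * q ^ (1 - 2 * m) = (q ^ 2) ^ (b - m) := by
        rw [← zpow_natCast q 2, ← zpow_mul, ← zpow_add₀ hq0]
        congr 1
        push_cast
        ring
      rw [← h]
      ring
    rw [← tsum_mul_left, tsum_congr key, Summable.tsum_sub (hsum _ _) (hs1.mul_left _),
      tsum_mul_left]
    simp only [Function.comp_def]
    rw [hshift]
    ring
  have hstep (a b : ℕ) : ∑' m, W a (b + 1 : ℕ) m * (1 - (q ^ 2) ^ (a + b + 1)) =
      (1 - q * (q ^ 2) ^ b) * ∑' m, W a b m := by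
    have := hrec a (b + 1 : ℕ)
    rw [tsum_mul_right, mul_comm]
    convert this using 3
    · rw [← zpow_natCast]
      push_cast
      ring_nf
    · rw [← pow_mul, ← pow_succ', ← zpow_natCast]
      push_cast
      ring_nf
    · push_cast
      ring_nf
  have hsymm (a b : ℤ) : ∑' m, W a b m = ∑' m, W b a m := by
    rw [← (Equiv.neg ℤ).tsum_eq]
    refine tsum_congr fun m ↦ ?_
    simp only [hW, Equiv.neg_apply, neg_sq, zpow_neg, ← inv_zpow, inv_neg, inv_one]
    rw [← sub_eq_add_neg, sub_neg_eq_add]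
    ring
  have hind (a b : ℕ) (h0 : ∑' m, W a 0 m = qPoch (q ^ 2) q a * invPoch (q ^ 2) a) :
      ∑' m, W a b m = qPoch (q ^ 2) q a * qPoch (q ^ 2) q b *
        invPoch (q ^ 2) ((a + b : ℕ) : ℤ) := by
    induction b with
    | zero => simpa [qPoch] using h0
    | succ b ih =>
      have hne := one_sub_pow_succ_ne_zero hp (a + b)
      refine mul_right_cancel₀ hne ?_
      rw [← tsum_mul_right, hstep, ih]
      have := one_sub_zpow_mul_invPoch hp ((a + (b + 1) : ℕ) : ℤ)
      rw [show ((a + (b + 1) : ℕ) : ℤ) - 1 = (a + b : ℕ) by push_cast; ring, zpow_natCast] at this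
      rw [← this, qPoch, qPoch, qPoch, Finset.prod_range_succ]
      ring_nf
  have h00 : ∑' m, W 0 0 m = 1 := by
    rw [tsum_eq_single 0]
    · simp [hW, invPoch_zero]
    · intro s hs
      rcases lt_or_ge s 0 with hs' | hs'
      · simp [hW, invPoch_of_neg _ hs']
      · simp [hW, invPoch_of_neg _ (show -s < 0 by lia)]
  refine hind a b ?_
  have := hind 0 a (by simpa [qPoch, invPoch_zero] using h00)
  rw [hsymm]
  simpa [qPoch] using this

lemma qPochInf_self_eq_mul {q : ℂ} (hq : ‖q‖ < 1) :
    qPochInf q q = qPochInf (q ^ 2) q * qPochInf (q ^ 2) (q ^ 2) := by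
  have h1 := multipliable_one_sub_mul_pow (norm_sq_lt_one hq) q
  have h2 := multipliable_one_sub_mul_pow (norm_sq_lt_one hq) (q ^ 2)
  have := tprod_even_mul_odd (f := fun j : ℕ ↦ 1 - q * q ^ j)
    (by simpa only [pow_mul] using h1)
    (by refine h2.congr fun j ↦ ?_; ring)
  rw [qPochInf, ← this, qPochInf, qPochInf]
  congr 1 <;> refine tprod_congr fun j ↦ ?_ <;> ring

/-- Gauss' product for `∑ (-1)^m q^(m^2)`. -/
lemma tsum_neg_one_zpow_mul_zpow_sq {q : ℂ} (hq : ‖q‖ < 1) (hq0 : q ≠ 0) :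
    ∑' m : ℤ, (-1) ^ m * q ^ (m ^ 2) = qPochInf q q ^ 2 / qPochInf (q ^ 2) (q ^ 2) := by
  have hp := norm_sq_lt_one hq
  obtain ⟨C, hC0, hC⟩ := exists_norm_invPoch_le hp
  have hP := qPochInf_self_ne_zero hp
  set P := qPochInf (q ^ 2) (q ^ 2) with hPdef
  have hcast : Tendsto (fun N : ℕ ↦ (N : ℤ)) atTop atTop := tendsto_natCast_atTop_atTop
  have hlim := tendsto_tsum_of_dominated_convergence (𝓕 := atTop)
    (f := fun (N : ℕ) (m : ℤ) ↦
      (-1) ^ m * q ^ (m ^ 2) * (invPoch (q ^ 2) (N + m) * invPoch (q ^ 2) (N - m)))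
    (g := fun m ↦ (-1) ^ m * q ^ (m ^ 2) * (P⁻¹ * P⁻¹))
    ((summable_pow_natAbs (norm_nonneg q) hq).mul_right (C * C))
    (fun m ↦ (((tendsto_invPoch hp).comp (tendsto_atTop_add_const_right _ m hcast)).mul
      ((tendsto_invPoch hp).comp (tendsto_atTop_add_const_right _ (-m) hcast))).const_mul _)
    (Eventually.of_forall fun N m ↦ by
      rw [norm_mul, norm_mul, norm_mul, norm_zpow, norm_neg, norm_one, one_zpow, one_mul]
      have h : (m.natAbs : ℤ) ≤ m ^ 2 := by
        rw [← Int.natAbs_sq]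
        exact_mod_cast Nat.le_self_pow two_ne_zero _
      have h' := norm_zpow_le_of_le hq hq0 h
      rw [zpow_natCast] at h'
      gcongr <;> exact hC _)
  simp only [tsum_neg_one_zpow_mul_invPoch hq hq0, tsum_mul_right] at hlim
  have hlim' : Tendsto (fun N : ℕ ↦ qPoch (q ^ 2) q N * qPoch (q ^ 2) q N *
      invPoch (q ^ 2) ((N + N : ℕ) : ℤ)) atTop
      (𝓝 (qPochInf (q ^ 2) q * qPochInf (q ^ 2) q * P⁻¹)) :=
    ((tendsto_qPoch hp q).mul (tendsto_qPoch hp q)).mul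
      ((tendsto_invPoch hp).comp (hcast.comp (tendsto_atTop_mono (fun N ↦ N.le_add_left N) tendsto_id)))
  have := tendsto_nhds_unique hlim hlim'
  rw [qPochInf_self_eq_mul hq, ← hPdef]
  field_simp at this ⊢
  exact this

lemma neg_one_zpow_eq_of_even {a b : ℤ} (h : Even (a - b)) : (-1 : ℂ) ^ a = (-1) ^ b := by
  rw [← sub_add_cancel a b, zpow_add₀ (neg_ne_zero.mpr one_ne_zero), h.neg_one_zpow, one_mul]

/-- The signed theta series of the hexagonal lattice as a product of two Gauss sums. -/
lemma tsum_hexagonal {q : ℂ} (hq0 : q ≠ 0)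
    (hsum : Summable fun x : ℤ × ℤ ↦
      (-1 : ℂ) ^ (x.1 + x.2) * q ^ (x.1 ^ 2 + x.2 ^ 2 - x.1 * x.2)) :
    ∑' x : ℤ × ℤ, (-1 : ℂ) ^ (x.1 + x.2) * q ^ (x.1 ^ 2 + x.2 ^ 2 - x.1 * x.2) =
      (∑' m : ℤ, (-1) ^ m * q ^ (m ^ 2)) * ∑' m : ℤ, (-1) ^ m * (q ^ 3) ^ (m ^ 2) := by
  rw [hsum.tsum_prod]
  have hodd (n : ℤ) (hn : Odd n) :
      ∑' m : ℤ, (-1 : ℂ) ^ (n + m) * q ^ (n ^ 2 + m ^ 2 - n * m) = 0 := by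
    have h := (Equiv.subLeft n).tsum_eq
      fun m : ℤ ↦ (-1 : ℂ) ^ (n + m) * q ^ (n ^ 2 + m ^ 2 - n * m)
    have hneg (m : ℤ) : (-1 : ℂ) ^ (n + (n - m)) * q ^ (n ^ 2 + (n - m) ^ 2 - n * (n - m)) =
        -((-1 : ℂ) ^ (n + m) * q ^ (n ^ 2 + m ^ 2 - n * m)) := by
      rw [neg_one_zpow_eq_of_even (b := n + m + 1) (by
          obtain ⟨c, rfl⟩ := hn
          exact ⟨c - m, by ring⟩),
        zpow_add_one₀ (neg_ne_zero.mpr one_ne_zero),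
        show n ^ 2 + (n - m) ^ 2 - n * (n - m) = n ^ 2 + m ^ 2 - n * m by ring]
      ring
    simp only [Equiv.subLeft_apply, hneg, tsum_neg] at h
    exact self_eq_neg.mp h.symm
  have hinj : Function.Injective fun k : ℤ ↦ 2 * k := fun a b h ↦ by simpa using h
  rw [← hinj.tsum_eq (fun n hn ↦ by
    rcases Int.even_or_odd' n with ⟨c, rfl | rfl⟩
    · exact ⟨c, rfl⟩
    · exact absurd (hodd _ ⟨c, rfl⟩) hn), ← tsum_mul_left]
  refine tsum_congr fun k ↦ ?_
  rw [← tsum_mul_right, ← (Equiv.addRight k).tsum_eq]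
  refine tsum_congr fun m ↦ ?_
  simp only [Equiv.coe_addRight]
  rw [neg_one_zpow_eq_of_even (b := m + k) ⟨k, by ring⟩,
    zpow_add₀ (neg_ne_zero.mpr one_ne_zero),
    show (2 * k) ^ 2 + (m + k) ^ 2 - 2 * k * (m + k) = m ^ 2 + 3 * k ^ 2 by ring,
    zpow_add₀ hq0, zpow_mul q 3, zpow_ofNat]
  ring

lemma tsum_prod_const_mul_mul {f g : ℤ → ℂ} {c : ℂ}
    (h : Summable fun x : ℤ × ℤ ↦ c * (f x.1 * g x.2)) :
    ∑' x : ℤ × ℤ, c * (f x.1 * g x.2) = c * ((∑' s, f s) * ∑' t, g t) := by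
  rw [h.tsum_prod]
  simp only [tsum_mul_left, tsum_mul_right]

/-- The integral quadratic form extending `Q4`. -/
def intQ4 (n : ℤ × ℤ × ℤ × ℤ × ℤ × ℤ) : ℤ :=
  match n with
  | (n₁, n₂, n₃, n₄, n₅, n₆) =>
    n₁ ^ 2 + n₂ ^ 2 + n₄ ^ 2 + n₅ ^ 2 + (n₁ + n₃ + n₄ + n₆) * (n₂ + n₃ + n₅ + n₆)

/-- The summand of the six-fold series, extended by zero to integer indices. -/
noncomputable def summand (q : ℂ) (n : ℤ × ℤ × ℤ × ℤ × ℤ × ℤ) : ℂ :=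
  (-1) ^ (n.1 + n.2.1 + n.2.2.2.1 + n.2.2.2.2.1) * q ^ intQ4 n *
    (invPoch (q ^ 2) n.1 * invPoch (q ^ 2) n.2.1 * invPoch (q ^ 2) n.2.2.1 *
      invPoch (q ^ 2) n.2.2.2.1 * invPoch (q ^ 2) n.2.2.2.2.1 * invPoch (q ^ 2) n.2.2.2.2.2)

lemma summand_eq_zero (q : ℂ) {n : ℤ × ℤ × ℤ × ℤ × ℤ × ℤ}
    (h : n.1 < 0 ∨ n.2.1 < 0 ∨ n.2.2.1 < 0 ∨ n.2.2.2.1 < 0 ∨ n.2.2.2.2.1 < 0 ∨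
      n.2.2.2.2.2 < 0) : summand q n = 0 := by
  rcases h with h | h | h | h | h | h <;> simp [summand, invPoch_of_neg _ h]

lemma summable_summand {q : ℂ} (hq : ‖q‖ < 1) (hq0 : q ≠ 0) : Summable (summand q) := by
  obtain ⟨C, hC0, hC⟩ := exists_norm_invPoch_le (norm_sq_lt_one hq)
  have hw := summable_pow_natAbs (norm_nonneg q) hq
  have hw0 : 0 ≤ fun n : ℤ ↦ ‖q‖ ^ n.natAbs := fun n ↦ by positivity
  have h2 := hw.mul_of_nonneg hw hw0 hw0
  have h3 := hw.mul_of_nonneg h2 hw0 (fun n ↦ by positivity)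
  have h4 := hw.mul_of_nonneg h3 hw0 (fun n ↦ by positivity)
  have h5 := hw.mul_of_nonneg h4 hw0 (fun n ↦ by positivity)
  have h6 := hw.mul_of_nonneg h5 hw0 (fun n ↦ by positivity)
  refine (h6.mul_right (C * C * C * C * C * C)).of_norm_bounded fun n ↦ ?_
  by_cases hn : n.1 < 0 ∨ n.2.1 < 0 ∨ n.2.2.1 < 0 ∨ n.2.2.2.1 < 0 ∨ n.2.2.2.2.1 < 0 ∨
      n.2.2.2.2.2 < 0
  · rw [summand_eq_zero q hn, norm_zero]
    positivity
  obtain ⟨a, b, c, d, e, f⟩ := n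
  simp only [not_or, not_lt] at hn
  obtain ⟨ha, hb, hc, hd, he, hf⟩ := hn
  lift a to ℕ using ha
  lift b to ℕ using hb
  lift c to ℕ using hc
  lift d to ℕ using hd
  lift e to ℕ using he
  lift f to ℕ using hf
  have hle : ((a + (b + (c + (d + (e + f)))) : ℕ) : ℤ) ≤ intQ4 (a, b, c, d, e, f) := by
    have hsq (x : ℕ) : x ≤ x ^ 2 := Nat.le_self_pow two_ne_zero x
    have h : a + (b + (c + (d + (e + f)))) ≤
        a ^ 2 + b ^ 2 + d ^ 2 + e ^ 2 + (a + c + d + f) * (b + c + e + f) := by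
      nlinarith [hsq a, hsq b, hsq d, hsq e, hsq (c + f), Nat.zero_le ((a + d) * (b + e)),
        Nat.zero_le ((a + d) * (c + f)), Nat.zero_le ((c + f) * (b + e))]
    simp only [intQ4]
    exact_mod_cast h
  have hpow := norm_zpow_le_of_le hq hq0 hle
  rw [zpow_natCast, pow_add, pow_add, pow_add, pow_add, pow_add] at hpow
  simp only [summand, norm_mul, norm_zpow (-1 : ℂ), norm_neg, norm_one, one_zpow, one_mul,
    Int.natAbs_natCast]
  gcongr <;> exact hC _

/-- Reindexing that exposes the two q-Vandermonde sums. -/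
def vandermondeEquiv : (ℤ × ℤ × ℤ × ℤ) × (ℤ × ℤ) ≃ ℤ × ℤ × ℤ × ℤ × ℤ × ℤ where
  toFun x := (x.1.1 - x.2.1, x.1.2.1 - x.2.1, x.2.1, x.1.2.2.1 - x.2.2, x.1.2.2.2 - x.2.2, x.2.2)
  invFun n := ((n.1 + n.2.2.1, n.2.1 + n.2.2.1, n.2.2.2.1 + n.2.2.2.2.2,
    n.2.2.2.2.1 + n.2.2.2.2.2), (n.2.2.1, n.2.2.2.2.2))
  left_inv x := by simp
  right_inv n := by simp

/-- Reindexing that exposes the two Durfee sums. -/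
def durfeeEquiv : (ℤ × ℤ) × (ℤ × ℤ) ≃ ℤ × ℤ × ℤ × ℤ where
  toFun x := (x.2.1 + x.1.1, x.2.2 + x.1.2, x.2.1, x.2.2)
  invFun n := ((n.1 - n.2.2.1, n.2.1 - n.2.2.2), (n.2.2.1, n.2.2.2))
  left_inv x := by simp
  right_inv n := by simp

lemma summand_vandermondeEquiv {q : ℂ} (hq0 : q ≠ 0) (i j k l s t : ℤ) :
    summand q (vandermondeEquiv ((i, j, k, l), (s, t))) =
      (-1) ^ (i + j + k + l) * q ^ ((i - j) ^ 2 + (k - l) ^ 2 + (i + k) * (j + l)) *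
        (((q ^ 2) ^ ((i - s) * (j - s)) *
          (invPoch (q ^ 2) (i - s) * invPoch (q ^ 2) (j - s) * invPoch (q ^ 2) s)) *
        ((q ^ 2) ^ ((k - t) * (l - t)) *
          (invPoch (q ^ 2) (k - t) * invPoch (q ^ 2) (l - t) * invPoch (q ^ 2) t))) := by
  have h : q ^ intQ4 (i - s, j - s, s, k - t, l - t, t) =
      q ^ ((i - j) ^ 2 + (k - l) ^ 2 + (i + k) * (j + l)) *
        ((q ^ 2) ^ ((i - s) * (j - s)) * (q ^ 2) ^ ((k - t) * (l - t))) := by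
    rw [← zpow_natCast q 2, ← zpow_mul, ← zpow_mul, ← zpow_add₀ hq0, ← zpow_add₀ hq0]
    simp only [intQ4]
    congr 1
    push_cast
    ring
  simp only [summand, vandermondeEquiv, Equiv.coe_fn_mk]
  rw [h, neg_one_zpow_eq_of_even (b := i + j + k + l) ⟨-s - t, by ring⟩]
  ring

/-- The four-fold summand left after the q-Vandermonde sums. -/
noncomputable def fourfoldSummand (q : ℂ) (x : ℤ × ℤ × ℤ × ℤ) : ℂ :=
  (-1) ^ (x.1 + x.2.1 + x.2.2.1 + x.2.2.2) *
    q ^ ((x.1 - x.2.1) ^ 2 + (x.2.2.1 - x.2.2.2) ^ 2 + (x.1 + x.2.2.1) * (x.2.1 + x.2.2.2)) *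
    ((invPoch (q ^ 2) x.1 * invPoch (q ^ 2) x.2.1) *
      (invPoch (q ^ 2) x.2.2.1 * invPoch (q ^ 2) x.2.2.2))

lemma fourfoldSummand_durfeeEquiv {q : ℂ} (hq0 : q ≠ 0) (m n k l : ℤ) :
    fourfoldSummand q (durfeeEquiv ((m, n), (k, l))) =
      (-1) ^ (m + n) * q ^ (m ^ 2 + n ^ 2 - m * n) *
        (((q ^ 2) ^ (k * (k + m)) * (invPoch (q ^ 2) (k + m) * invPoch (q ^ 2) k)) *
          ((q ^ 2) ^ (l * (l + n)) * (invPoch (q ^ 2) (l + n) * invPoch (q ^ 2) l))) := by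
  have h : q ^ ((k + m - (l + n)) ^ 2 + (k - l) ^ 2 + (k + m + k) * (l + n + l)) =
      q ^ (m ^ 2 + n ^ 2 - m * n) * ((q ^ 2) ^ (k * (k + m)) * (q ^ 2) ^ (l * (l + n))) := by
    rw [← zpow_natCast q 2, ← zpow_mul, ← zpow_mul, ← zpow_add₀ hq0, ← zpow_add₀ hq0]
    congr 1
    push_cast
    ring
  simp only [fourfoldSummand, durfeeEquiv, Equiv.coe_fn_mk]
  rw [h, neg_one_zpow_eq_of_even (b := m + n) ⟨k + l, by ring⟩]
  ring

lemma hasSum_fourfoldSummand {q : ℂ} (hq : ‖q‖ < 1) (hq0 : q ≠ 0) :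
    HasSum (fourfoldSummand q) (∑' n, summand q n) := by
  have hp := norm_sq_lt_one hq
  have hp0 : q ^ 2 ≠ 0 := pow_ne_zero 2 hq0
  have h6 := vandermondeEquiv.hasSum_iff.mpr (summable_summand hq hq0).hasSum
  refine h6.prod_fiberwise fun ⟨i, j, k, l⟩ ↦ ?_
  have hs := h6.summable.prod_factor (i, j, k, l)
  have hfun : (fun y : ℤ × ℤ ↦ (summand q ∘ vandermondeEquiv) ((i, j, k, l), y)) = fun y ↦ _ :=
    funext fun y ↦ summand_vandermondeEquiv hq0 i j k l y.1 y.2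
  rw [hfun] at hs ⊢
  refine hs.hasSum_iff.mpr ?_
  refine (tsum_prod_const_mul_mul
    (f := fun s ↦ (q ^ 2) ^ ((i - s) * (j - s)) *
      (invPoch (q ^ 2) (i - s) * invPoch (q ^ 2) (j - s) * invPoch (q ^ 2) s))
    (g := fun t ↦ (q ^ 2) ^ ((k - t) * (l - t)) *
      (invPoch (q ^ 2) (k - t) * invPoch (q ^ 2) (l - t) * invPoch (q ^ 2) t)) hs).trans ?_
  rw [tsum_invPoch_mul_mul hp hp0, tsum_invPoch_mul_mul hp hp0]
  rfl

lemma hasSum_hexagonal {q : ℂ} (hq : ‖q‖ < 1) (hq0 : q ≠ 0) :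
    HasSum (fun x : ℤ × ℤ ↦ (-1 : ℂ) ^ (x.1 + x.2) * q ^ (x.1 ^ 2 + x.2 ^ 2 - x.1 * x.2) *
      ((qPochInf (q ^ 2) (q ^ 2))⁻¹ * (qPochInf (q ^ 2) (q ^ 2))⁻¹)) (∑' n, summand q n) := by
  have hp := norm_sq_lt_one hq
  have hp0 : q ^ 2 ≠ 0 := pow_ne_zero 2 hq0
  have h4 := durfeeEquiv.hasSum_iff.mpr (hasSum_fourfoldSummand hq hq0)
  refine h4.prod_fiberwise fun ⟨m, n⟩ ↦ ?_
  have hs := h4.summable.prod_factor (m, n)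
  have hfun : (fun y : ℤ × ℤ ↦ (fourfoldSummand q ∘ durfeeEquiv) ((m, n), y)) = fun y ↦ _ :=
    funext fun y ↦ fourfoldSummand_durfeeEquiv hq0 m n y.1 y.2
  rw [hfun] at hs ⊢
  refine hs.hasSum_iff.mpr ?_
  refine (tsum_prod_const_mul_mul
    (f := fun k ↦ (q ^ 2) ^ (k * (k + m)) * (invPoch (q ^ 2) (k + m) * invPoch (q ^ 2) k))
    (g := fun l ↦ (q ^ 2) ^ (l * (l + n)) * (invPoch (q ^ 2) (l + n) * invPoch (q ^ 2) l))
    hs).trans ?_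
  rw [tsum_durfee hp hp0, tsum_durfee hp hp0]

lemma tsum_summand {q : ℂ} (hq : ‖q‖ < 1) (hq0 : q ≠ 0) :
    ∑' n, summand q n =
      ((∑' m : ℤ, (-1) ^ m * q ^ (m ^ 2)) * ∑' m : ℤ, (-1) ^ m * (q ^ 3) ^ (m ^ 2)) *
        ((qPochInf (q ^ 2) (q ^ 2))⁻¹ * (qPochInf (q ^ 2) (q ^ 2))⁻¹) := by
  have hP := inv_ne_zero (qPochInf_self_ne_zero (norm_sq_lt_one hq))
  have h := hasSum_hexagonal hq hq0
  rw [← h.tsum_eq, tsum_mul_right,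
    tsum_hexagonal hq0 ((summable_mul_right_iff (mul_ne_zero hP hP)).mp h.summable)]

/-- The inclusion of natural six-tuples into integral six-tuples. -/
def castTuple (n : ℕ × ℕ × ℕ × ℕ × ℕ × ℕ) : ℤ × ℤ × ℤ × ℤ × ℤ × ℤ :=
  (n.1, n.2.1, n.2.2.1, n.2.2.2.1, n.2.2.2.2.1, n.2.2.2.2.2)

lemma castTuple_injective : Function.Injective castTuple := by
  rintro ⟨a, b, c, d, e, f⟩ ⟨a', b', c', d', e', f'⟩ h
  simpa [castTuple] using h

lemma support_summand_subset (q : ℂ) :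
    Function.support (summand q) ⊆ Set.range castTuple := by
  rintro ⟨a, b, c, d, e, f⟩ hn
  have h := mt (summand_eq_zero q) hn
  simp only [not_or, not_lt] at h
  exact ⟨(a.toNat, b.toNat, c.toNat, d.toNat, e.toNat, f.toNat), by simp [castTuple, h]⟩

lemma summand_castTuple (q : ℂ) (n₁ n₂ n₃ n₄ n₅ n₆ : ℕ) :
    summand q (castTuple (n₁, n₂, n₃, n₄, n₅, n₆)) =
      (-1 : ℂ) ^ (n₁ + n₂ + n₄ + n₅) * q ^ Q4 n₁ n₂ n₃ n₄ n₅ n₆ /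
        (qPoch (q ^ 2) (q ^ 2) n₁ * qPoch (q ^ 2) (q ^ 2) n₂ *
          qPoch (q ^ 2) (q ^ 2) n₃ * qPoch (q ^ 2) (q ^ 2) n₄ *
          qPoch (q ^ 2) (q ^ 2) n₅ * qPoch (q ^ 2) (q ^ 2) n₆) := by
  have hQ : intQ4 (n₁, n₂, n₃, n₄, n₅, n₆) = (Q4 n₁ n₂ n₃ n₄ n₅ n₆ : ℕ) := by
    simp only [intQ4, Q4]
    push_cast
    ring
  simp only [summand, castTuple, hQ, zpow_natCast, invPoch_natCast, div_eq_mul_inv, mul_inv]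
  norm_cast

/-- $\sum_{N_1,\dots,N_6\ge0} (-1)^{N_1+N_2+N_4+N_5} q^{N^TG_4N}/\prod_i(q^2;q^2)_{N_i}
 = (q;q)_\infty^2(q^3;q^3)_\infty^2/((q^2;q^2)_\infty^3(q^6;q^6)_\infty)$. -/
theorem G4_signed (q : ℂ) (hq : ‖q‖ < 1) :
    (∑' n : ℕ × ℕ × ℕ × ℕ × ℕ × ℕ,
        match n with
        | (n₁, n₂, n₃, n₄, n₅, n₆) =>
          (-1 : ℂ) ^ (n₁ + n₂ + n₄ + n₅) * q ^ Q4 n₁ n₂ n₃ n₄ n₅ n₆ /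
            (qPoch (q ^ 2) (q ^ 2) n₁ * qPoch (q ^ 2) (q ^ 2) n₂ *
              qPoch (q ^ 2) (q ^ 2) n₃ * qPoch (q ^ 2) (q ^ 2) n₄ *
              qPoch (q ^ 2) (q ^ 2) n₅ * qPoch (q ^ 2) (q ^ 2) n₆))
      = qPochInf q q ^ 2 * qPochInf (q ^ 3) (q ^ 3) ^ 2 /
          (qPochInf (q ^ 2) (q ^ 2) ^ 3 * qPochInf (q ^ 6) (q ^ 6)) := by
  rcases eq_or_ne q 0 with rfl | hq0
  · rw [tsum_eq_single (0, 0, 0, 0, 0, 0)]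
    · simp [Q4, qPoch, qPochInf]
    · rintro ⟨a, b, c, d, e, f⟩ hn
      have hQ : Q4 a b c d e f ≠ 0 := by
        intro h
        simp only [Q4, Nat.add_eq_zero_iff] at h
        simp_all
      simp [zero_pow hQ]
  have hq3 : ‖q ^ 3‖ < 1 := by
    rw [norm_pow]
    exact pow_lt_one₀ (norm_nonneg _) hq three_ne_zero
  have h := tsum_summand hq hq0
  rw [← castTuple_injective.tsum_eq (support_summand_subset q),
    tsum_neg_one_zpow_mul_zpow_sq hq hq0,
    tsum_neg_one_zpow_mul_zpow_sq hq3 (pow_ne_zero 3 hq0), ← pow_mul] at h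
  refine (tsum_congr ?_).trans (h.trans ?_)
  · rintro ⟨a, b, c, d, e, f⟩
    exact (summand_castTuple q a b c d e f).symm
  · rw [div_mul_div_comm, ← mul_inv, ← div_eq_mul_inv, div_div]
    congr 1
    ring
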